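/- Let i be a nonnegative integer and let α, β, ε be complex numbers. Assume that (β)_{m+n} and (1+α−β+ε+i)_n are nonzero for all nonnegative integers m, n, that no argument of Γ appearing on the right-hand side below is a nonpositive integer, and that the double series defining the Kampé de Fériet function converges absolutely. Then F^{1:1;2}_{1:0;1}[α : ε ; β−ε, 1+α−2β+ε+i ; β : — ; 1+α−β+ε+i ; 1/2, 1/2] = (2^{i+α−2β+2ε} · Γ(β−ε−i) · Γ(1+α−β+ε+i)) / (Γ(β−ε) · Γ(1+α−2β+2ε+i)) · Σ_{r=0}^{i} (−1)^r · C(i,r) · Γ(ε−β+(1+α+i+r)/2) / Γ((1+α−i+r)/2). -/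

import Mathlib

open Complex

noncomputable section

/-- Pochhammer symbol `(a)_n = a (a+1) ⋯ (a+n-1)`. -/
def poch (a : ℂ) (n : ℕ) : ℂ := ∏ k ∈ Finset.range n, (a + k)

/-- `z` is not a nonpositive integer. -/
def notNonposInt (z : ℂ) : Prop := ∀ n : ℕ, z ≠ -(n : ℂ)

/-- Term of the Kampé de Fériet double series `F^{1:1;2}_{1:0;1}`. -/
def kdfTerm (α ε b₁ b₂ β d₁ x y : ℂ) (p : ℕ × ℕ) : ℂ :=
  poch α (p.1 + p.2) * poch ε p.1 * poch b₁ p.2 * poch b₂ p.2 /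
    (poch β (p.1 + p.2) * poch d₁ p.2) * x ^ p.1 * y ^ p.2 /
    ((p.1.factorial : ℂ) * (p.2.factorial : ℂ))

theorem poch_zero (a : ℂ) : poch a 0 = 1 := by simp [poch]

theorem poch_succ (a : ℂ) (n : ℕ) : poch a (n + 1) = poch a n * (a + n) := by
  simp [poch, Finset.prod_range_succ]

theorem poch_succ_left (a : ℂ) (n : ℕ) : poch a (n + 1) = a * poch (a + 1) n := by
  rw [poch, Finset.prod_range_succ', poch, mul_comm]
  push_cast
  simp [add_assoc, add_comm (1 : ℂ)]

theorem poch_mul_Gamma {a : ℂ} (ha : notNonposInt a) (n : ℕ) :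
    poch a n * Gamma a = Gamma (a + n) := by
  induction n with
  | zero => simp [poch_zero]
  | succ n ih =>
    have h : a + n ≠ 0 := fun h => ha n (eq_neg_of_add_eq_zero_left h)
    rw [poch_succ, mul_right_comm, ih]
    push_cast
    rw [← add_assoc, Gamma_add_one _ h, mul_comm]

theorem inv_Gamma_eq (s : ℂ) : (Gamma s)⁻¹ = s * (Gamma (s + 1))⁻¹ := by
  simpa using one_div_Gamma_eq_self_mul_one_div_Gamma_add_one s

/-- The Pfaff–Saalschütz sum: the coefficient form of Euler's transformation of `₂F₁`. -/
theorem sum_antidiagonal_poch (e a b c : ℂ) (he : e = c - a - b) (hc : ∀ n, poch c n ≠ 0) (N : ℕ) :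
    ∑ p ∈ Finset.HasAntidiagonal.antidiagonal N, poch e p.1 / (p.1.factorial : ℂ) *
        (poch a p.2 * poch b p.2 / (poch c p.2 * (p.2.factorial : ℂ))) =
      poch (c - a) N * poch (c - b) N / (poch c N * (N.factorial : ℂ)) := by
  have hfac : ∀ n : ℕ, (n.factorial : ℂ) ≠ 0 := fun n => by exact_mod_cast n.factorial_ne_zero
  have hcn : ∀ n : ℕ, c + n ≠ 0 := fun n h => hc (n + 1) (by rw [poch_succ, h, mul_zero])
  set u : ℕ → ℂ := fun k => poch e k / (k.factorial : ℂ) with hu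
  set v : ℕ → ℂ := fun n => poch a n * poch b n / (poch c n * (n.factorial : ℂ)) with hv
  have hu1 : ∀ k : ℕ, ((k : ℂ) + 1) * u (k + 1) = (e + k) * u k := by
    intro k
    have := hfac k
    have h1 : (k : ℂ) + 1 ≠ 0 := by exact_mod_cast k.succ_ne_zero
    simp only [hu, poch_succ, Nat.factorial_succ]
    push_cast
    field_simp
  have hv1 : ∀ n : ℕ, (c + n) * ((n : ℂ) + 1) * v (n + 1) = (a + n) * (b + n) * v n := by
    intro n
    have := hfac n
    have h1 : (n : ℂ) + 1 ≠ 0 := by exact_mod_cast n.succ_ne_zero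
    have h2 := hcn n
    have h3 := hc n
    simp only [hv, poch_succ, Nat.factorial_succ]
    push_cast
    field_simp
  induction N with
  | zero => simp [poch_zero]
  | succ N ih =>
    have hN1 : (N : ℂ) + 1 ≠ 0 := by exact_mod_cast N.succ_ne_zero
    have hrec : ((N : ℂ) + 1) * (c + N) *
          ∑ p ∈ Finset.HasAntidiagonal.antidiagonal (N + 1), u p.1 * v p.2 =
        (c - a + N) * (c - b + N) * ∑ p ∈ Finset.HasAntidiagonal.antidiagonal N, u p.1 * v p.2 := by
      have hG : ∀ m ≤ N + 1,
          ∑ n ∈ Finset.range m, (((N : ℂ) + 1) * (c + N) * (u (N + 1 - n) * v n) -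
            (c - a + N) * (c - b + N) * (u (N - n) * v n)) =
          - ((m : ℂ) * (c + m - 1) * v m * u (N + 1 - m)) := by
        intro m hm
        induction m with
        | zero => simp
        | succ m ihm =>
          obtain ⟨k, rfl⟩ : ∃ k, N = m + k := ⟨N - m, by omega⟩
          rw [Finset.sum_range_succ, ihm (by omega)]
          have e1 : m + k + 1 - m = k + 1 := by omega
          have e2 : m + k - m = k := by omega
          have e3 : m + k + 1 - (m + 1) = k := by omega
          rw [e1, e2, e3]
          have H1 := hu1 k
          have H2 := hv1 m
          push_cast
          subst he
          have hk : (k : ℂ) + 1 ≠ 0 := by exact_mod_cast k.succ_ne_zero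
          have hu2 : u (k + 1) = (c - a - b + k) * u k / (k + 1) := by
            rw [← H1]; field_simp
          have : (m + 1 : ℂ) * (c + (m + 1) - 1) * v (m + 1) * u k
              = (a + m) * (b + m) * v m * u k := by rw [← H2]; ring
          rw [this, hu2]
          field_simp
          ring
      have h := hG (N + 1) le_rfl
      rw [Finset.sum_sub_distrib, ← Finset.mul_sum, ← Finset.mul_sum] at h
      rw [← Finset.Nat.sum_antidiagonal_swap, ← Finset.Nat.sum_antidiagonal_swap (n := N),
        Finset.Nat.sum_antidiagonal_eq_sum_range_succ_mk,
        Finset.Nat.sum_antidiagonal_eq_sum_range_succ_mk, Finset.sum_range_succ]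
      simp only [Prod.fst_swap, Prod.snd_swap]
      push_cast at h
      rw [Nat.sub_self] at h ⊢
      linear_combination h
    rw [ih] at hrec
    have h2 := hcn N
    have h3 := hc N
    have h4 := hfac N
    rw [← mul_right_inj' (mul_ne_zero hN1 h2), hrec, poch_succ, poch_succ, poch_succ,
      Nat.factorial_succ]
    push_cast
    field_simp

/-- The terms of the regularized series `₂F₁(a, b; c; 1/2) / Γ(c)`. -/
def regTerm (a b c : ℂ) (n : ℕ) : ℂ :=
  poch a n * poch b n * (Gamma (c + n))⁻¹ * (1 / 2) ^ n / (n.factorial : ℂ)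

theorem regTerm_symm (a b c : ℂ) (n : ℕ) : regTerm a b c n = regTerm b a c n := by
  simp only [regTerm]; ring

theorem summable_regTerm (a b c : ℂ) : Summable (regTerm a b c) := by
  have hlim : Filter.Tendsto (fun n : ℕ => ‖(a + n) * (b + n) / ((c + n) * (n + 1)) * (1 / 2)‖)
      Filter.atTop (nhds (1 / 2)) := by
    have h (s : ℂ) : Filter.Tendsto (fun n : ℕ => s / (n : ℂ) + 1) Filter.atTop (nhds 1) := by
      simpa using (tendsto_const_div_atTop_nhds_zero_nat s).add_const 1
    have := (((h a).mul (h b)).div ((h c).mul (h 1)) (by simp)).mul_const (1 / 2)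
    have h2 := this.norm
    have h3 : ‖(1 * 1 / (1 * 1) * (1 / 2) : ℂ)‖ = 1 / 2 := by norm_num
    rw [h3] at h2
    refine h2.congr' ?_
    filter_upwards [Filter.eventually_gt_atTop 0] with n hn
    have hn' : (n : ℂ) ≠ 0 := by exact_mod_cast hn.ne'
    congr 2
    simp only [Pi.div_apply]
    rw [div_add_one hn', div_add_one hn', div_add_one hn', div_add_one hn']
    rw [div_mul_div_comm, div_mul_div_comm, div_div_div_cancel_right₀ (mul_ne_zero hn' hn'),
      add_comm 1]
  refine summable_of_ratio_norm_eventually_le (r := 3 / 4) (by norm_num) ?_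
  have hc : ∀ᶠ n : ℕ in Filter.atTop, c + n ≠ 0 := by
    filter_upwards [Filter.eventually_gt_atTop ⌈‖c‖⌉₊] with n hn h
    have h1 : ‖c‖ = n := by rw [eq_neg_of_add_eq_zero_left h]; simp
    have h2 := Nat.lt_of_ceil_lt hn
    linarith
  filter_upwards [hlim.eventually_le_const (show (1 / 2 : ℝ) < 3 / 4 by norm_num), hc] with n hn hcn
  have h1 : (n : ℂ) + 1 ≠ 0 := by exact_mod_cast n.succ_ne_zero
  have h2 : (n.factorial : ℂ) ≠ 0 := by exact_mod_cast n.factorial_ne_zero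
  have : regTerm a b c (n + 1) =
      (a + n) * (b + n) / ((c + n) * (n + 1)) * (1 / 2) * regTerm a b c n := by
    simp only [regTerm, poch_succ, Nat.factorial_succ, pow_succ]
    rw [inv_Gamma_eq (c + n)]
    push_cast
    rw [← add_assoc]
    field_simp
  rw [this, norm_mul]
  gcongr

/-- The regularized series `₂F₁(a, b; c; 1/2) / Γ(c)`. -/
def regF (a b c : ℂ) : ℂ := ∑' n, regTerm a b c n

theorem hasSum_regF (a b c : ℂ) : HasSum (regTerm a b c) (regF a b c) :=
  (summable_regTerm a b c).hasSum

theorem regF_symm (a b c : ℂ) : regF a b c = regF b a c :=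
  tsum_congr fun n => regTerm_symm a b c n

theorem eq_zero_of_hasSum_telescoping {f g : ℕ → ℂ} {s : ℂ} (hf : HasSum f s) (hg : Summable g)
    (h0 : f 0 = g 0) (h : ∀ n, f (n + 1) = g (n + 1) - g n) : s = 0 := by
  have hsum : ∀ n, ∑ k ∈ Finset.range (n + 1), f k = g n := by
    intro n
    induction n with
    | zero => simpa using h0
    | succ n ih => rw [Finset.sum_range_succ, ih, h]; ring
  refine tendsto_nhds_unique ((Filter.tendsto_add_atTop_iff_nat 1).2 hf.tendsto_sum_nat) ?_
  simpa only [hsum] using hg.tendsto_atTop_zero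

/-- A contiguous relation for `₂F₁` at `1/2`. -/
theorem regF_contiguous (a b c : ℂ) :
    (c - 1 - b) * regF a b c = regF (a - 1) b (c - 1) - b / 2 * regF a (b + 1) c := by
  have H := ((hasSum_regF a b c).mul_left (c - 1 - b)).sub
    ((hasSum_regF (a - 1) b (c - 1)).sub ((hasSum_regF a (b + 1) c).mul_left (b / 2)))
  rw [← sub_eq_zero]
  refine eq_zero_of_hasSum_telescoping H ((summable_regTerm a (b + 1) c).mul_left (-(b / 2))) ?_ ?_
  · simp only [regTerm, poch_zero, Nat.cast_zero, add_zero]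
    rw [inv_Gamma_eq (c - 1)]
    simp
    ring
  · intro n
    have h1 : (n : ℂ) + 1 ≠ 0 := by exact_mod_cast n.succ_ne_zero
    have h2 : (n.factorial : ℂ) ≠ 0 := by exact_mod_cast n.factorial_ne_zero
    simp only [regTerm]
    rw [poch_succ_left (a - 1), poch_succ a, poch_succ (b + 1), poch_succ_left b,
      Nat.factorial_succ, sub_add_cancel]
    push_cast
    rw [show c - 1 + (n + 1 : ℂ) = c + n by ring, inv_Gamma_eq (c + n), add_assoc c]
    field_simp
    ring

/-- The parameter recurrence behind Gauss's second summation theorem. -/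
theorem regF_recurrence (a b : ℂ) :
    regF a b ((a + b + 1) / 2) = (a + 1) / 2 * regF (a + 2) b ((a + 2 + b + 1) / 2) := by
  have H := (hasSum_regF a b ((a + b + 1) / 2)).sub
    ((hasSum_regF (a + 2) b ((a + 2 + b + 1) / 2)).mul_left ((a + 1) / 2))
  rw [← sub_eq_zero]
  refine eq_zero_of_hasSum_telescoping H
    ((summable_regTerm (a + 1) (b + 1) ((a + b + 1) / 2 + 1)).mul_left (b / 2)) ?_ ?_
  · simp only [regTerm, poch_zero, Nat.cast_zero, add_zero]
    rw [inv_Gamma_eq ((a + b + 1) / 2)]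
    ring_nf
  · intro n
    have h1 : (n : ℂ) + 1 ≠ 0 := by exact_mod_cast n.succ_ne_zero
    have h2 : (n.factorial : ℂ) ≠ 0 := by exact_mod_cast n.factorial_ne_zero
    have h3 : (a + 1) * poch (a + 2) (n + 1) =
        poch (a + 1) n * (a + 1 + n) * (a + 2 + n) := by
      rw [show a + 2 = a + 1 + 1 by ring, ← poch_succ_left, poch_succ, poch_succ]
      push_cast
      ring
    have h4 (c : ℂ) : (a + 1) / 2 * regTerm (a + 2) b c (n + 1) =
        poch (a + 1) n * (a + 1 + n) * (a + 2 + n) * poch b (n + 1) *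
          (Gamma (c + (n + 1 : ℕ)))⁻¹ * (1 / 2) ^ (n + 1) / ((n + 1).factorial : ℂ) / 2 := by
      rw [regTerm, ← h3]
      ring
    rw [h4]
    simp only [regTerm]
    rw [show (a + 2 + b + 1) / 2 = (a + b + 1) / 2 + 1 by ring, poch_succ_left a,
      poch_succ (a + 1), poch_succ (b + 1), poch_succ_left b, Nat.factorial_succ]
    push_cast
    rw [show (a + b + 1) / 2 + 1 + (n : ℂ) = (a + b + 1) / 2 + (n + 1) by ring,
      inv_Gamma_eq ((a + b + 1) / 2 + (n + 1)),
      show (a + b + 1) / 2 + 1 + (n + 1 : ℂ) = (a + b + 1) / 2 + (n + 1) + 1 by ring]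
    field_simp
    ring

theorem hasSum_poch_binomial (a : ℂ) {z : ℂ} (hz : ‖z‖ < 1) :
    HasSum (fun n : ℕ => poch a n / (n.factorial : ℂ) * z ^ n) ((1 - z) ^ (-a)) := by
  have h := (one_div_one_sub_cpow_hasFPowerSeriesOnBall_zero a).hasSum (y := z) (by
    rw [Metric.mem_eball, edist_zero_right, ← ofReal_norm]
    exact ENNReal.ofReal_lt_one.2 hz)
  have hpoch : ∀ n : ℕ, poch a n = (ascPochhammer ℂ n).eval a := by
    intro n
    induction n with
    | zero => simp [poch_zero]
    | succ n ih => rw [poch_succ, ih, ascPochhammer_succ_eval]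
  rw [zero_add, one_div, ← cpow_neg] at h
  refine h.congr_fun fun n => ?_
  have hf : (n.factorial : ℂ) ≠ 0 := by exact_mod_cast n.factorial_ne_zero
  have hm := Ring.factorial_nsmul_multichoose_eq_ascPochhammer a n
  rw [Polynomial.ascPochhammer_smeval_eq_eval, ← hpoch, nsmul_eq_mul, Ring.multichoose_eq] at hm
  rw [← hm]
  simp
  field_simp

theorem ofReal_cpow_eq_exp {x : ℝ} (hx : 0 < x) (w : ℂ) : (x : ℂ) ^ w = exp (Real.log x * w) := by
  rw [cpow_def_of_ne_zero (by exact_mod_cast hx.ne'), ofReal_log hx.le]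

/-- Euler's integral for the regularized `₂F₁` at `1/2`. -/
theorem regF_mul_Gamma_eq_integral (a b c : ℂ) (hb : 0 < b.re) (hcb : 0 < (c - b).re) :
    regF a b c * (Gamma b * Gamma (c - b)) =
      ∫ t in (0 : ℝ)..1, (t : ℂ) ^ (b - 1) * (1 - (t : ℂ)) ^ (c - b - 1) *
        (1 - (t : ℂ) / 2) ^ (-a) := by
  set B : ℝ → ℂ := fun t => (t : ℂ) ^ (b - 1) * (1 - (t : ℂ)) ^ (c - b - 1) with hB
  set A : ℕ → ℂ := fun n => poch a n / (n.factorial : ℂ) with hA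
  have hBint : IntervalIntegrable B MeasureTheory.volume 0 1 := betaIntegral_convergent hb hcb
  have hAsum : Summable fun n => ‖A n * (1 / 2) ^ n‖ :=
    (hasSum_poch_binomial a (z := 1 / 2) (by norm_num)).summable.norm
  have hsum : HasSum (fun n : ℕ => ∫ t in (0 : ℝ)..1, B t * (A n * ((t : ℂ) / 2) ^ n))
      (∫ t in (0 : ℝ)..1, B t * (1 - (t : ℂ) / 2) ^ (-a)) := by
    refine intervalIntegral.hasSum_integral_of_dominated_convergence
      (fun n t => ‖B t‖ * ‖A n * (1 / 2) ^ n‖) (fun n => ?_) (fun n => ?_) ?_ ?_ ?_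
    · refine hBint.def'.aestronglyMeasurable.mul (Continuous.aestronglyMeasurable ?_)
      fun_prop
    · refine Filter.Eventually.of_forall fun t ht => ?_
      rw [Set.uIoc_of_le zero_le_one] at ht
      rw [norm_mul, norm_mul (A n), norm_mul (A n), norm_pow, norm_pow]
      gcongr
      rw [norm_div, norm_div, norm_real, Real.norm_eq_abs, abs_of_pos ht.1, norm_one]
      gcongr
      exact ht.2
    · exact Filter.Eventually.of_forall fun t _ => hAsum.mul_left _
    · simp only [tsum_mul_left]
      exact hBint.norm.mul_const _
    · refine Filter.Eventually.of_forall fun t ht => ?_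
      rw [Set.uIoc_of_le zero_le_one] at ht
      refine (hasSum_poch_binomial a ?_).mul_left _
      rw [norm_div, norm_real, Real.norm_eq_abs, abs_of_pos ht.1]
      norm_num
      linarith [ht.2]
  refine ((hasSum_regF a b c).mul_right (Gamma b * Gamma (c - b))).unique ?_
  refine hsum.congr_fun fun n => ?_
  have hbn : 0 < (b + n).re := by simp; positivity
  have hbeta : ∫ t in (0 : ℝ)..1, B t * (A n * ((t : ℂ) / 2) ^ n) =
      A n * (1 / 2) ^ n * betaIntegral (b + n) (c - b) := by
    rw [betaIntegral, ← intervalIntegral.integral_const_mul]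
    refine intervalIntegral.integral_congr_ae (Filter.Eventually.of_forall fun t ht => ?_)
    rw [Set.uIoc_of_le zero_le_one] at ht
    have ht0 : (t : ℂ) ≠ 0 := by exact_mod_cast ht.1.ne'
    rw [show b + n - 1 = b - 1 + n by ring, cpow_add _ _ ht0, cpow_natCast]
    simp only [hB, div_pow]
    ring
  have hb' : notNonposInt b := by
    rintro m rfl
    simp at hb
    linarith [m.cast_nonneg (α := ℝ)]
  rw [hbeta, betaIntegral_eq_Gamma_mul_div _ _ hbn hcb, ← poch_mul_Gamma hb', regTerm,
    show b + n + (c - b) = c + n by ring]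
  simp only [hA]
  ring

theorem integral_eq_betaIntegral (b q : ℂ) :
    ∫ t in (0 : ℝ)..1, (t : ℂ) ^ (b - 1) * (1 - (t : ℂ)) ^ (q - 1) *
        (1 - (t : ℂ) / 2) ^ (-(2 * q + b - 1)) =
      2 ^ (b - 1) * betaIntegral (b / 2) q := by
  set g : ℝ → ℂ := fun t => (t : ℂ) ^ (b - 1) * (1 - (t : ℂ)) ^ (q - 1) *
    (1 - (t : ℂ) / 2) ^ (-(2 * q + b - 1)) with hg
  set h : ℝ → ℂ := fun u => (u : ℂ) ^ (b / 2 - 1) * (1 - (u : ℂ)) ^ (q - 1) with hh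
  have h1 := intervalIntegral.integral_deriv_smul_comp_of_deriv_nonneg (a := 0) (b := 1)
    (f := fun s : ℝ => 2 * s / (1 + s)) (f' := fun s => 2 / (1 + s) ^ 2) (g := g)
    (by
      refine ContinuousOn.div (by fun_prop) (by fun_prop) fun s hs => ?_
      rw [Set.uIcc_of_le zero_le_one] at hs
      linarith [hs.1])
    (by
      intro s hs
      have hs0 : 0 < s := by simpa using hs.1
      have : 1 + s ≠ 0 := by positivity
      refine HasDerivAt.congr_deriv (f := fun s : ℝ => 2 * s / (1 + s))
        (((hasDerivAt_id s).const_mul 2).div ((hasDerivAt_id s).const_add 1) this) ?_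
      simp only [id_eq]
      field_simp
      ring)
    (fun s _ => by positivity)
  have h2 := intervalIntegral.integral_deriv_smul_comp_of_deriv_nonneg (a := 0) (b := 1)
    (f := fun s : ℝ => s ^ 2) (f' := fun s => 2 * s) (g := h) (by fun_prop)
    (by
      intro s hs
      simpa using hasDerivAt_pow 2 s)
    (fun s hs => by
      simp only [zero_le_one, min_eq_left, max_eq_right] at hs
      linarith [hs.1])
  simp only [Function.comp_apply, real_smul] at h1 h2
  rw [show (2 * 0 / (1 + 0) : ℝ) = 0 by norm_num, show (2 * 1 / (1 + 1) : ℝ) = 1 by norm_num] at h1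
  rw [zero_pow two_ne_zero, one_pow] at h2
  rw [betaIntegral, ← h1, ← h2, ← intervalIntegral.integral_const_mul]
  refine intervalIntegral.integral_congr_ae ?_
  filter_upwards [MeasureTheory.Measure.ae_ne MeasureTheory.volume (1 : ℝ)] with s hs1 hs
  rw [Set.uIoc_of_le zero_le_one] at hs
  have hs0 : 0 < s := hs.1
  have hs1' : 0 < 1 - s := sub_pos.2 (lt_of_le_of_ne hs.2 hs1)
  have hs2 : 0 < 1 + s := by linarith
  have e1 : ((2 * s / (1 + s) : ℝ) : ℂ) ^ (b - 1) =
      exp ((Real.log 2 + Real.log s - Real.log (1 + s)) * (b - 1)) := by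
    rw [ofReal_cpow_eq_exp (by positivity), Real.log_div (by positivity) hs2.ne',
      Real.log_mul two_ne_zero hs0.ne']
    push_cast
    rfl
  have e2 : (1 - ((2 * s / (1 + s) : ℝ) : ℂ)) ^ (q - 1) =
      exp ((Real.log (1 - s) - Real.log (1 + s)) * (q - 1)) := by
    rw [← ofReal_one, ← ofReal_sub, show 1 - 2 * s / (1 + s) = (1 - s) / (1 + s) by field_simp; ring,
      ofReal_cpow_eq_exp (by positivity), Real.log_div hs1'.ne' hs2.ne']
    push_cast
    rfl
  have e3 : (1 - ((2 * s / (1 + s) : ℝ) : ℂ) / 2) ^ (-(2 * q + b - 1)) =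
      exp (Real.log (1 + s) * (2 * q + b - 1)) := by
    rw [← ofReal_ofNat, ← ofReal_div, ← ofReal_one, ← ofReal_sub,
      show 1 - 2 * s / (1 + s) / 2 = (1 + s)⁻¹ by field_simp; ring,
      ofReal_cpow_eq_exp (by positivity), Real.log_inv]
    push_cast
    ring_nf
  have e4 : ((2 / (1 + s) ^ 2 : ℝ) : ℂ) = exp (Real.log 2 - 2 * Real.log (1 + s)) := by
    rw [← Real.exp_log (show 0 < 2 / (1 + s) ^ 2 by positivity),
      Real.log_div two_ne_zero (by positivity), Real.log_pow]
    push_cast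
    rfl
  have e5 : ((s ^ 2 : ℝ) : ℂ) ^ (b / 2 - 1) = exp (2 * Real.log s * (b / 2 - 1)) := by
    rw [ofReal_cpow_eq_exp (by positivity), Real.log_pow]
    push_cast
    rfl
  have e6 : (1 - ((s ^ 2 : ℝ) : ℂ)) ^ (q - 1) =
      exp ((Real.log (1 - s) + Real.log (1 + s)) * (q - 1)) := by
    rw [← ofReal_one, ← ofReal_sub, show 1 - s ^ 2 = (1 - s) * (1 + s) by ring,
      ofReal_cpow_eq_exp (by positivity), Real.log_mul hs1'.ne' hs2.ne']
    push_cast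
    rfl
  have e7 : ((2 * s : ℝ) : ℂ) = exp (Real.log 2 + Real.log s) := by
    rw [← Real.exp_log (show 0 < 2 * s by positivity), Real.log_mul two_ne_zero hs0.ne']
    push_cast
    rfl
  have e8 : (2 : ℂ) ^ (b - 1) = exp (Real.log 2 * (b - 1)) := by
    rw [← ofReal_ofNat, ofReal_cpow_eq_exp two_pos]
  have L : ((2 / (1 + s) ^ 2 : ℝ) : ℂ) * g (2 * s / (1 + s)) =
      2 ^ (b - 1) * (((2 * s : ℝ) : ℂ) * h (s ^ 2)) := by
    simp only [hg, hh]
    rw [e1, e2, e3, e4, e5, e6, e7, e8]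
    simp only [← exp_add]
    ring_nf
  exact L

theorem regF_gauss_of_re (a b : ℂ) (hb : 0 < b.re) (hab : b.re - 1 < a.re) :
    regF a b ((a + b + 1) / 2) = (√Real.pi : ℂ) * (Gamma ((a + 1) / 2))⁻¹ * (Gamma ((b + 1) / 2))⁻¹ := by
  set q : ℂ := (a - b + 1) / 2 with hq
  have hq0 : 0 < q.re := by
    simp [hq]
    linarith
  have hb2 : 0 < (b / 2).re := by simpa using hb
  have h := regF_mul_Gamma_eq_integral a b ((a + b + 1) / 2) hb
    (by rwa [show (a + b + 1) / 2 - b = q by ring])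
  rw [show (a + b + 1) / 2 - b = q by ring, show a = 2 * q + b - 1 by ring,
    integral_eq_betaIntegral, betaIntegral_eq_Gamma_mul_div _ _ hb2 hq0,
    show 2 * q + b - 1 = a by ring, show b / 2 + q = (a + 1) / 2 by ring] at h
  have hdup := Gamma_mul_Gamma_add_half (b / 2)
  rw [show 2 * (b / 2) = b by ring, show b / 2 + 1 / 2 = (b + 1) / 2 by ring] at hdup
  have g1 : Gamma b ≠ 0 := Gamma_ne_zero_of_re_pos hb
  have g2 : Gamma q ≠ 0 := Gamma_ne_zero_of_re_pos hq0
  have g3 : Gamma ((b + 1) / 2) ≠ 0 := Gamma_ne_zero_of_re_pos (by simp; linarith)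
  have g4 : Gamma ((a + 1) / 2) ≠ 0 := Gamma_ne_zero_of_re_pos (by simp; linarith)
  have h2 : (2 : ℂ) ^ (b - 1) * 2 ^ (1 - b) = 1 := by
    rw [← cpow_add _ _ two_ne_zero]
    simp
  rw [← mul_left_inj' (mul_ne_zero g1 g2), h]
  field_simp
  linear_combination (2 : ℂ) ^ (b - 1) * hdup + Gamma b * (√Real.pi : ℂ) * h2

/-- Gauss's second summation theorem, in regularized form. -/
theorem regF_gauss (a b : ℂ) :
    regF a b ((a + b + 1) / 2) = (√Real.pi : ℂ) * (Gamma ((a + 1) / 2))⁻¹ * (Gamma ((b + 1) / 2))⁻¹ := by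
  have step (a b : ℂ) (h : regF (a + 2) b ((a + 2 + b + 1) / 2) =
      (√Real.pi : ℂ) * (Gamma ((a + 2 + 1) / 2))⁻¹ * (Gamma ((b + 1) / 2))⁻¹) :
      regF a b ((a + b + 1) / 2) =
        (√Real.pi : ℂ) * (Gamma ((a + 1) / 2))⁻¹ * (Gamma ((b + 1) / 2))⁻¹ := by
    rw [regF_recurrence, h, inv_Gamma_eq ((a + 1) / 2), show (a + 1) / 2 + 1 = (a + 2 + 1) / 2 by ring]
    ring
  have half (b : ℂ) (hb : 0 < b.re) (a : ℂ) : regF a b ((a + b + 1) / 2) =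
      (√Real.pi : ℂ) * (Gamma ((a + 1) / 2))⁻¹ * (Gamma ((b + 1) / 2))⁻¹ := by
    have (k : ℕ) : ∀ a : ℂ, b.re - 1 < a.re + 2 * k → regF a b ((a + b + 1) / 2) =
        (√Real.pi : ℂ) * (Gamma ((a + 1) / 2))⁻¹ * (Gamma ((b + 1) / 2))⁻¹ := by
      induction k with
      | zero => exact fun a ha => regF_gauss_of_re a b hb (by simpa using ha)
      | succ k ih =>
        refine fun a ha => step a b (ih (a + 2) ?_)
        push_cast at ha
        simp
        linarith
    obtain ⟨k, hk⟩ := exists_nat_gt (b.re - 1 - a.re)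
    exact this k a (by linarith [k.cast_nonneg (α := ℝ)])
  have (k : ℕ) : ∀ b : ℂ, 0 < b.re + 2 * k → regF a b ((a + b + 1) / 2) =
      (√Real.pi : ℂ) * (Gamma ((a + 1) / 2))⁻¹ * (Gamma ((b + 1) / 2))⁻¹ := by
    induction k with
    | zero => exact fun b hb => half b (by simpa using hb) a
    | succ k ih =>
      intro b hb
      have h := ih (b + 2) (by push_cast at hb; simp; linarith)
      rw [regF_symm, add_comm a b, mul_right_comm]
      refine step b a ?_
      rw [regF_symm, add_comm _ a, h, mul_right_comm]
  obtain ⟨k, hk⟩ := exists_nat_gt (-b.re)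
  exact this k b (by linarith [k.cast_nonneg (α := ℝ)])

/-- The alternating sum of Gamma quotients in the generalized Gauss theorem. -/
def altGammaSum (i : ℕ) (a b : ℂ) : ℂ :=
  ∑ r ∈ Finset.range (i + 1), (-1 : ℂ) ^ r * (i.choose r : ℂ) *
    (Gamma ((b + r) / 2) / Gamma ((a - i + r + 1) / 2))

theorem altGammaSum_succ (i : ℕ) (a b : ℂ) :
    altGammaSum (i + 1) a b = altGammaSum i (a - 1) b - altGammaSum i a (b + 1) := by
  unfold altGammaSum
  rw [Finset.sum_range_succ']
  have h (r : ℕ) : (-1 : ℂ) ^ (r + 1) * ((i + 1).choose (r + 1) : ℂ) *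
      (Gamma ((b + (r + 1 : ℕ)) / 2) / Gamma ((a - (i + 1 : ℕ) + (r + 1 : ℕ) + 1) / 2)) =
      (-1 : ℂ) ^ (r + 1) * (i.choose (r + 1) : ℂ) *
        (Gamma ((b + (r + 1 : ℕ)) / 2) / Gamma ((a - 1 - i + (r + 1 : ℕ) + 1) / 2)) -
      (-1 : ℂ) ^ r * (i.choose r : ℂ) *
        (Gamma ((b + 1 + r) / 2) / Gamma ((a - i + r + 1) / 2)) := by
    rw [Nat.choose_succ_succ]
    push_cast
    rw [show a - (i + 1 : ℂ) + (r + 1) + 1 = a - i + r + 1 by ring,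
      show a - 1 - (i : ℂ) + (r + 1) + 1 = a - i + r + 1 by ring,
      show b + (r + 1 : ℂ) = b + 1 + r by ring]
    ring
  rw [Finset.sum_congr rfl fun r _ => h r, Finset.sum_sub_distrib]
  have h2 := Finset.sum_range_succ' (fun r : ℕ => (-1 : ℂ) ^ r * (i.choose r : ℂ) *
    (Gamma ((b + r) / 2) / Gamma ((a - 1 - i + r + 1) / 2))) (i + 1)
  rw [Finset.sum_range_succ, Nat.choose_succ_self] at h2
  simp only [Nat.cast_zero, mul_zero, zero_mul, add_zero, pow_zero, Nat.choose_zero_right] at h2 ⊢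
  push_cast at h2 ⊢
  rw [h2, show a - (i + 1 : ℂ) = a - 1 - i by ring]
  ring

theorem notNonposInt.add_one {b : ℂ} (hb : notNonposInt b) : notNonposInt (b + 1) := by
  intro n h
  refine hb (n + 1) ?_
  push_cast
  linear_combination h

/-- A generalization of Gauss's second summation theorem, in regularized form. -/
theorem regF_generalized_gauss (i : ℕ) (a b : ℂ) (hb : notNonposInt b) :
    regF a b ((a + b + 1 + i) / 2) * poch ((a - b - i + 1) / 2) i * Gamma b =
      2 ^ (b - 1) * altGammaSum i a b := by
  induction i generalizing a b with
  | zero =>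
    have hdup := Gamma_mul_Gamma_add_half (b / 2)
    rw [show 2 * (b / 2) = b by ring, show b / 2 + 1 / 2 = (b + 1) / 2 by ring] at hdup
    have h2 : (2 : ℂ) ^ (b - 1) * 2 ^ (1 - b) = 1 := by
      rw [← cpow_add _ _ two_ne_zero]
      simp
    have g : Gamma ((b + 1) / 2) ≠ 0 := Gamma_ne_zero fun m hm => hb (2 * m + 1) (by
      push_cast
      linear_combination 2 * hm)
    simp only [altGammaSum, poch_zero, Nat.cast_zero, add_zero, sub_zero, zero_add,
      Finset.sum_range_one, pow_zero, Nat.choose_self, Nat.cast_one, one_mul, mul_one]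
    rw [regF_gauss, div_eq_mul_inv _ (Gamma ((a + 1) / 2))]
    field_simp
    linear_combination -(2 : ℂ) ^ (b - 1) * (Gamma ((a + 1) / 2))⁻¹ * hdup -
      Gamma b * (√Real.pi : ℂ) * (Gamma ((a + 1) / 2))⁻¹ * h2
  | succ i ih =>
    have hb0 : b ≠ 0 := by simpa using hb 0
    have h1 := ih (a - 1) b hb
    have h2 := ih a (b + 1) hb.add_one
    have h3 := regF_contiguous a b ((a + b + 1 + (i + 1 : ℕ)) / 2)
    have h4 : (2 : ℂ) ^ (b + 1 - 1) = 2 * 2 ^ (b - 1) := by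
      rw [show b + 1 - 1 = 1 + (b - 1) by ring, cpow_add _ _ two_ne_zero, cpow_one]
    rw [Gamma_add_one b hb0, h4] at h2
    rw [altGammaSum_succ, poch_succ]
    push_cast at h1 h2 h3 ⊢
    rw [show (a + (b + 1) + 1 + (i : ℂ)) / 2 = (a + b + 1 + (i + 1)) / 2 by ring,
      show (a - (b + 1) - (i : ℂ) + 1) / 2 = (a - b - (i + 1) + 1) / 2 by ring] at h2
    rw [show (a - 1 + b + 1 + (i : ℂ)) / 2 = (a + b + 1 + (i + 1)) / 2 - 1 by ring,
      show (a - 1 - b - (i : ℂ) + 1) / 2 = (a - b - (i + 1) + 1) / 2 by ring] at h1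
    linear_combination h1 - h2 / 2 + poch ((a - b - (i + 1) + 1) / 2) i * Gamma b * h3

theorem sum_antidiagonal_kdfTerm (α e a b β c x : ℂ) (he : e = c - a - b) (hβ : β = c - b)
    (hc : ∀ n, poch c n ≠ 0) (hβ0 : ∀ n, poch β n ≠ 0) (N : ℕ) :
    ∑ p ∈ Finset.HasAntidiagonal.antidiagonal N, kdfTerm α e a b β c x x p =
      poch α N * poch (c - a) N / (poch c N * (N.factorial : ℂ)) * x ^ N := by
  have h (p : ℕ × ℕ) (hp : p ∈ Finset.HasAntidiagonal.antidiagonal N) :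
      kdfTerm α e a b β c x x p = poch α N / poch β N * x ^ N *
        (poch e p.1 / (p.1.factorial : ℂ) *
        (poch a p.2 * poch b p.2 / (poch c p.2 * (p.2.factorial : ℂ)))) := by
    rw [Finset.HasAntidiagonal.mem_antidiagonal] at hp
    subst hp
    rw [kdfTerm, pow_add]
    ring
  rw [Finset.sum_congr rfl h, ← Finset.mul_sum, sum_antidiagonal_poch e a b c he hc, ← hβ]
  have := hβ0 N
  have := hc N
  field_simp

/-- Reduction of the double series to a single one by the Pfaff–Saalschütz sum. -/
theorem tsum_kdfTerm (α e a b β c : ℂ) (he : e = c - a - b) (hβ : β = c - b)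
    (hc : notNonposInt c) (hβ0 : ∀ n, poch β n ≠ 0)
    (hsum : Summable (kdfTerm α e a b β c (1 / 2) (1 / 2))) :
    ∑' p, kdfTerm α e a b β c (1 / 2) (1 / 2) p = Gamma c * regF α (c - a) c := by
  have hc0 (n : ℕ) : poch c n ≠ 0 := fun h => by
    have := poch_mul_Gamma hc n
    rw [h, zero_mul] at this
    exact Gamma_ne_zero (fun m hm => hc (n + m) (by push_cast; linear_combination hm)) this.symm
  rw [← Finset.HasAntidiagonal.sigmaAntidiagonalEquivProd.tsum_eq]
  have hs := (Finset.HasAntidiagonal.sigmaAntidiagonalEquivProd (A := ℕ)).summable_iff.2 hsum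
  refine (Summable.tsum_sigma' (fun n => (hasSum_fintype _).summable) hs).trans ?_
  rw [regF, ← tsum_mul_left]
  refine tsum_congr fun N => ?_
  rw [tsum_fintype]
  refine (Finset.sum_coe_sort (Finset.HasAntidiagonal.antidiagonal N)
    (kdfTerm α e a b β c (1 / 2) (1 / 2))).trans ?_
  rw [sum_antidiagonal_kdfTerm α e a b β c _ he hβ hc0 hβ0, regTerm, ← poch_mul_Gamma hc N]
  have := hc0 N
  have := Gamma_ne_zero hc
  field_simp

theorem stmt_2 (i : ℕ) (α β ε : ℂ)
    (hβ : ∀ m n : ℕ, poch β (m + n) ≠ 0)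
    (hd : ∀ n : ℕ, poch (1 + α - β + ε + (i : ℂ)) n ≠ 0)
    (hΓ1 : notNonposInt (β - ε - (i : ℂ)))
    (hΓ2 : notNonposInt (1 + α - β + ε + (i : ℂ)))
    (hΓ3 : notNonposInt (β - ε))
    (hΓ4 : notNonposInt (1 + α - 2 * β + 2 * ε + (i : ℂ)))
    (hΓs : ∀ r : ℕ, r ≤ i →
      notNonposInt (ε - β + (1 + α + (i : ℂ) + (r : ℂ)) / 2) ∧ notNonposInt ((1 + α - (i : ℂ) + (r : ℂ)) / 2))
    (hsum : Summable fun p : ℕ × ℕ => ‖kdfTerm α ε (β - ε) (1 + α - 2 * β + ε + (i : ℂ)) β (1 + α - β + ε + (i : ℂ)) (1/2) (1/2) p‖) :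
    (∑' p : ℕ × ℕ, kdfTerm α ε (β - ε) (1 + α - 2 * β + ε + (i : ℂ)) β (1 + α - β + ε + (i : ℂ)) (1/2) (1/2) p) =
      (2 : ℂ) ^ ((i : ℂ) + α - 2 * β + 2 * ε) * Gamma (β - ε - (i : ℂ)) * Gamma (1 + α - β + ε + (i : ℂ)) /
        (Gamma (β - ε) * Gamma (1 + α - 2 * β + 2 * ε + (i : ℂ))) *
      ∑ r ∈ Finset.range (i + 1), (-1 : ℂ) ^ r * (i.choose r : ℂ) *
        Gamma (ε - β + (1 + α + (i : ℂ) + (r : ℂ)) / 2) /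
        Gamma ((1 + α - (i : ℂ) + (r : ℂ)) / 2) := by
  rw [tsum_kdfTerm α ε (β - ε) (1 + α - 2 * β + ε + i) β (1 + α - β + ε + i) (by ring) (by ring)
    hΓ2 (fun n => by simpa using hβ 0 n) hsum.of_norm]
  have h := regF_generalized_gauss i α _ hΓ4
  have hg := poch_mul_Gamma hΓ1 i
  rw [sub_add_cancel] at hg
  have hT : ∑ r ∈ Finset.range (i + 1), (-1 : ℂ) ^ r * (i.choose r : ℂ) *
      Gamma (ε - β + (1 + α + (i : ℂ) + (r : ℂ)) / 2) / Gamma ((1 + α - (i : ℂ) + (r : ℂ)) / 2) =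
      altGammaSum i α (1 + α - 2 * β + 2 * ε + i) := by
    refine Finset.sum_congr rfl fun r _ => ?_
    rw [mul_div_assoc, show ε - β + (1 + α + (i : ℂ) + (r : ℂ)) / 2 =
        (1 + α - 2 * β + 2 * ε + i + r) / 2 by ring,
      show 1 + α - (i : ℂ) + (r : ℂ) = α - i + r + 1 by ring]
  rw [show (α + (1 + α - 2 * β + 2 * ε + (i : ℂ)) + 1 + i) / 2 = 1 + α - β + ε + i by ring,
    show (α - (1 + α - 2 * β + 2 * ε + (i : ℂ)) - i + 1) / 2 = β - ε - i by ring,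
    show 1 + α - 2 * β + 2 * ε + (i : ℂ) - 1 = i + α - 2 * β + 2 * ε by ring] at h
  rw [hT, show 1 + α - β + ε + (i : ℂ) - (β - ε) = 1 + α - 2 * β + 2 * ε + i by ring]
  have g3 := Gamma_ne_zero hΓ3
  have g4 := Gamma_ne_zero hΓ4
  rw [div_mul_eq_mul_div, eq_div_iff (mul_ne_zero g3 g4), ← hg]
  linear_combination Gamma (1 + α - β + ε + i) * Gamma (β - ε - i) * h
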